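/- arXiv:2407.14913 — 2 statements merged into one kernel-verified Lean document; each statement's English description precedes it below -/
import Mathlib

section
/- Let (A,•,ω) be a symplectic left Leibniz algebra over a field K of characteristic zero, with A finite-dimensional, let ⋆ be the bilinear product determined by ω(u⋆v, w) = −ω(v, u•w) for all u,v,w ∈ A, and set I = Leib(A) ∩ Leib(A)^⊥. Then for all u,v ∈ A and all w ∈ I: u•v ∈ I^⊥, u⋆v ∈ I^⊥, u•w = 0, u⋆w = 0, w•u = 0, and w⋆u = 0. -/
/-- The orthogonal of a subspace `S` with respect to a bilinear form `ω`. -/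
def perp {K A : Type*} [Field K] [AddCommGroup A] [Module K A]
    (ω : A →ₗ[K] A →ₗ[K] K) (S : Submodule K A) : Submodule K A where
  carrier := {x : A | ∀ s ∈ S, ω x s = 0}
  add_mem' := fun {x y} hx hy s hs => by
    simp [map_add, LinearMap.add_apply, hx s hs, hy s hs]
  zero_mem' := fun s hs => by simp
  smul_mem' := fun c x hx s hs => by
    simp [map_smul, LinearMap.smul_apply, hx s hs]

/-- In a symplectic left Leibniz algebra `(A, •, ω)` with `⋆` determined
by `ω(u⋆v, w) = −ω(v, u•w)` and `I = Leib(A) ∩ Leib(A)^⊥`, one has, for all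
`u, v ∈ A` and `w ∈ I`: `u•v ∈ I^⊥`, `u⋆v ∈ I^⊥`, `u•w = 0`, `u⋆w = 0`,
`w•u = 0` and `w⋆u = 0`. -/
theorem stmt7 {K A : Type*} [Field K] [CharZero K] [AddCommGroup A] [Module K A]
    [FiniteDimensional K A]
    (mul star : A →ₗ[K] A →ₗ[K] A) (ω : A →ₗ[K] A →ₗ[K] K)
    (hleib : ∀ u v w : A, mul u (mul v w) = mul (mul u v) w + mul v (mul u w))
    (hskew : ∀ u v : A, ω u v = - ω v u)
    (hnondeg : ∀ u : A, (∀ v : A, ω u v = 0) → u = 0)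
    (hsymp : ∀ u v w : A, ω u (mul v w) - ω v (mul u w)
      = (1/2 : K) * ω (mul u v) w - (1/2 : K) * ω (mul v u) w)
    (hstar : ∀ u v w : A, ω (star u v) w = - ω v (mul u w))
    (Leib I : Submodule K A)
    (hLeib : Leib = Submodule.span K {x : A | ∃ u v : A, x = mul u v + mul v u})
    (hI : I = Leib ⊓ perp ω Leib) :
    ∀ u v : A, ∀ w ∈ I,
      mul u v ∈ perp ω I ∧ star u v ∈ perp ω I ∧
        mul u w = 0 ∧ star u w = 0 ∧ mul w u = 0 ∧ star w u = 0 := by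
  have hext : ∀ x y : A, (∀ z, ω x z = ω y z) → x = y := fun x y h =>
    sub_eq_zero.1 (hnondeg _ fun z => by simp [h z])
  have hleft : ∀ w ∈ Leib, ∀ u, mul w u = 0 := by
    intro w hw u
    rw [hLeib] at hw
    induction hw using Submodule.span_induction with
    | mem x hx =>
      obtain ⟨a, b, rfl⟩ := hx
      have h₁ := hleib a b u
      have h₂ := hleib b a u
      rw [map_add, LinearMap.add_apply]
      grind
    | zero => simp
    | add x y _ _ hx hy => simp [hx, hy]
    | smul c x _ hx => simp [hx]
  have hstar_left : ∀ w ∈ Leib, ∀ u, star w u = 0 := fun w hw u =>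
    hnondeg _ fun x => by simp [hstar, hleft w hw x]
  have hcomm : ∀ u v, star u v - star v u = (1 / 2 : K) • (mul u v - mul v u) := by
    intro u v
    apply hext
    intro z
    simp only [map_sub, LinearMap.sub_apply, map_smul, LinearMap.smul_apply, smul_eq_mul, hstar]
    linear_combination hsymp u v z
  have hright : ∀ w ∈ Leib, ∀ u, star u w = (1 / 2 : K) • mul u w := by
    intro w hw u
    simpa [hstar_left w hw, hleft w hw] using hcomm u w
  intro u v w hw
  rw [hI] at hw
  obtain ⟨hwL, hwP⟩ := hw
  have hpair : ∀ x ∈ Leib, ∀ a b, ω x (mul a b) = -(1 / 2 : K) * ω (mul a x) b := by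
    intro x hx a b
    have h := hstar a x b
    rw [hright x hx, map_smul, LinearMap.smul_apply, smul_eq_mul] at h
    linear_combination h
  have hzero : ∀ x ∈ I, ∀ a, mul a x = 0 := by
    intro x hx a
    rw [hI] at hx
    obtain ⟨hxL, hxP⟩ := hx
    apply hnondeg
    intro b
    have hsum : ω x (mul a b) + ω x (mul b a) = 0 := by
      rw [← map_add]
      exact hxP _ (hLeib ▸ Submodule.subset_span ⟨a, b, rfl⟩)
    have h₁ := hpair x hxL a b
    have h₂ := hpair x hxL b a
    have h₃ := hsymp a b x
    rw [hskew a (mul b x), hskew b (mul a x), hskew (mul a b) x, hskew (mul b a) x] at h₃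
    linear_combination (2 / 3 : K) * h₃ + (2 / 3 : K) * h₁ + (4 / 3 : K) * h₂ - hsum
  have hmul : mul u w = 0 := hzero w (hI ▸ ⟨hwL, hwP⟩) u
  refine ⟨fun s hs => ?_, fun s hs => ?_, hmul, ?_, hleft w hwL u, hstar_left w hwL u⟩
  · rw [hskew, hpair s (hI ▸ hs : s ∈ Leib ⊓ perp ω Leib).1, hzero s hs]
    simp
  · rw [hstar, hzero s hs]
    simp
  · rw [hright w hwL, hmul, smul_zero]
end

section
/- Let A be a 2-dimensional vector space over a field K of characteristic zero, • a bilinear product on A satisfying both the left Leibniz identity u•(v•w) = (u•v)•w + v•(u•w) and the right Leibniz identity (v•w)•u = (v•u)•w + v•(w•u), and ω a nondegenerate skew-symmetric bilinear form on A satisfying both ω(u, v•w) − ω(v, u•w) = (1/2)ω(u•v, w) − (1/2)ω(v•u, w) and ω(u, w•v) − ω(v, w•u) = (1/2)ω(v•u, w) − (1/2)ω(u•v, w) for all u,v,w. Suppose • is not anticommutative, i.e., u•v + v•u ≠ 0 for some u,v ∈ A. Then there exist a basis (e₁, e₂) of A and a nonzero scalar x ∈ K such that ω(e₁, e₂) =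 1, e₂•e₂ = x·e₁, and e₁•e₁ = e₁•e₂ = e₂•e₁ = 0. -/
/-- A 2-dimensional bi-symplectic symmetric Leibniz algebra which is
not anticommutative has a basis `(e₁, e₂)` and a nonzero scalar `x` with
`ω(e₁,e₂) = 1`, `e₂•e₂ = x·e₁` and `e₁•e₁ = e₁•e₂ = e₂•e₁ = 0`. -/
theorem stmt19 {K A : Type*} [Field K] [CharZero K] [AddCommGroup A] [Module K A]
    [FiniteDimensional K A] (hdim : Module.finrank K A = 2)
    (mul : A →ₗ[K] A →ₗ[K] A) (ω : A →ₗ[K] A →ₗ[K] K)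
    (hlleib : ∀ u v w : A, mul u (mul v w) = mul (mul u v) w + mul v (mul u w))
    (hrleib : ∀ u v w : A, mul (mul v w) u = mul (mul v u) w + mul v (mul w u))
    (hskew : ∀ u v : A, ω u v = - ω v u)
    (hnondeg : ∀ u : A, (∀ v : A, ω u v = 0) → u = 0)
    (hsympl : ∀ u v w : A, ω u (mul v w) - ω v (mul u w)
      = (1/2 : K) * ω (mul u v) w - (1/2 : K) * ω (mul v u) w)
    (hsympr : ∀ u v w : A, ω u (mul w v) - ω v (mul w u)
      = (1/2 : K) * ω (mul v u) w - (1/2 : K) * ω (mul u v) w)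
    (hnotlie : ∃ u v : A, mul u v + mul v u ≠ 0) :
    ∃ (e₁ e₂ : A) (x : K), LinearIndependent K ![e₁, e₂] ∧
      Submodule.span K {e₁, e₂} = ⊤ ∧ x ≠ 0 ∧
      ω e₁ e₂ = 1 ∧ mul e₂ e₂ = x • e₁ ∧
      mul e₁ e₁ = 0 ∧ mul e₁ e₂ = 0 ∧ mul e₂ e₁ = 0 := by
  have mul_sq_left : ∀ u w : A, mul (mul u u) w = 0 := fun u w => by
    simpa using hlleib u u w
  have mul_sq_right : ∀ u v : A, mul v (mul u u) = 0 := fun u v => by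
    simpa using hrleib u v u
  obtain ⟨u, hu⟩ : ∃ u : A, mul u u ≠ 0 := by
    by_contra! h
    obtain ⟨u, v, huv⟩ := hnotlie
    apply huv
    simpa [h, add_comm] using h (u + v)
  have hli : LinearIndependent K ![mul u u, u] := by
    rw [LinearIndependent.pair_iff' hu]
    intro c hc
    apply hu
    conv_lhs => rw [← hc]
    simp [mul_sq_left]
  have span_eq_top : ∀ {a b : A}, LinearIndependent K ![a, b] →
      Submodule.span K {a, b} = ⊤ := fun {a b} hab => by
    simpa [Set.pair_comm] using hab.span_eq_top_of_card_eq_finrank' (by simp [hdim])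
  have hself : ω (mul u u) (mul u u) = 0 := self_eq_neg.mp (hskew _ _)
  have hω : ω (mul u u) u ≠ 0 := by
    intro h
    refine hu (hnondeg _ fun v => ?_)
    have hv : v ∈ Submodule.span K {mul u u, u} := by
      rw [span_eq_top hli]
      trivial
    obtain ⟨a, b, rfl⟩ := Submodule.mem_span_pair.mp hv
    simp [h, hself]
  have hli' : LinearIndependent K ![(ω (mul u u) u)⁻¹ • mul u u, u] := by
    rw [LinearIndependent.pair_iff] at hli ⊢
    intro a b hab
    obtain ⟨ha, hb⟩ := hli (a * (ω (mul u u) u)⁻¹) b (by rwa [mul_smul])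
    exact ⟨(mul_eq_zero.mp ha).resolve_right (inv_ne_zero hω), hb⟩
  exact ⟨(ω (mul u u) u)⁻¹ • mul u u, u, ω (mul u u) u, hli', span_eq_top hli', hω,
    by simp [hω], by simp [hω], by simp [mul_sq_left], by simp [mul_sq_left],
    by simp [mul_sq_right]⟩
end
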